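/- Let d ∈ ℕ with d ≥ 1, n ∈ [2,3], and c ∈ [1.55, n). Then (μ₂(Q₂), 0) ∩ A = ∅, where Q₂ ∈ (Q_*, 1) is the unique global minimizer of μ₂ on (Q_*, 1). -/

import Mathlib

open Set Filter Topology intervalIntegral Real

noncomputable section

/-- The rescaled traveling-wave ODE for the magma equation at a point `r`. -/
def magmaODE (d n c : ℝ) (Q : ℝ → ℝ) (r : ℝ) : Prop :=
  -deriv Q r + (1 / c) * deriv (fun s => Q s ^ n) r
    + deriv (fun s => Q s ^ n * deriv (deriv Q) s) r
    + (d - 1) * Q r ^ n * deriv (fun s => deriv Q s / s) r = 0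

/-- Solution of the IVP on `[0, σ]`. -/
def isIVPSolutionOn (d n c μ : ℝ) (Q : ℝ → ℝ) (σ : ℝ) : Prop :=
  ContDiffOn ℝ 3 Q (Icc 0 σ) ∧ (∀ r ∈ Ioo (0:ℝ) σ, magmaODE d n c Q r) ∧
    Q 0 = 1 ∧ deriv Q 0 = 0 ∧ deriv (deriv Q) 0 = μ

/-- Solution of the IVP on `[0, ∞)`. -/
def isIVPSolution (d n c μ : ℝ) (Q : ℝ → ℝ) : Prop :=
  ContDiffOn ℝ 3 Q (Ici 0) ∧ (∀ r : ℝ, 0 < r → magmaODE d n c Q r) ∧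
    Q 0 = 1 ∧ deriv Q 0 = 0 ∧ deriv (deriv Q) 0 = μ

def F1 (d n c : ℝ) (Q μ : ℝ) : ℝ :=
  -(1 / (n - 1)) * (Q ^ (1 - n) - 1) - (n / c) * Real.log Q + μ * d

def F2 (d n c : ℝ) (Q μ : ℝ) : ℝ :=
  ∫ q in (1:ℝ)..Q, F1 d n c q μ * q ^ n

def F3 (d n c : ℝ) (Q μ : ℝ) : ℝ :=
  F1 d n c Q μ - n * ∫ q in (1:ℝ)..Q, F2 d n c q μ * q ^ (-(n + 2))

def mu1 (d n c Q : ℝ) : ℝ := -(F1 d n c Q 0) / (F1 d n c Q 1 - F1 d n c Q 0)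
def mu2 (d n c Q : ℝ) : ℝ := -(F2 d n c Q 0) / (F2 d n c Q 1 - F2 d n c Q 0)
def mu3 (d n c Q : ℝ) : ℝ := -(F3 d n c Q 0) / (F3 d n c Q 1 - F3 d n c Q 0)

def h3ex (d n Q : ℝ) : ℝ :=
  d * (1 - n * Real.log Q / (n + 1) - n / (n + 1) ^ 2 * (Q ^ (-(n + 1)) - 1))

def setA (d n c Qs : ℝ) : Set ℝ :=
  {μ : ℝ | μ < 0 ∧ ∃ (Q : ℝ → ℝ) (σ rs : ℝ), 0 < rs ∧ rs < σ ∧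
    isIVPSolutionOn d n c μ Q σ ∧ (∀ r ∈ Ioc (0:ℝ) σ, 0 < Q r ∧ deriv Q r < 0) ∧
    Q rs = Qs}

lemma F1_continuousOn (d n c μ : ℝ) : ContinuousOn (fun q => F1 d n c q μ) (Ioi 0) := by
  intro q hq
  have hq0 : q ≠ 0 := ne_of_gt hq
  have h1 : ContinuousAt (fun q : ℝ => q ^ (1 - n)) q :=
    Real.continuousAt_rpow_const q _ (Or.inl hq0)
  have h2 : ContinuousAt Real.log q := Real.continuousAt_log hq0
  unfold F1
  exact ((((h1.sub continuousAt_const).const_mul _).sub (h2.const_mul _)).add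
    continuousAt_const).continuousWithinAt

lemma F1_mul_rpow_continuousOn (d n c μ : ℝ) :
    ContinuousOn (fun q => F1 d n c q μ * q ^ n) (Ioi 0) :=
  (F1_continuousOn d n c μ).mul fun _ hq =>
    (Real.continuousAt_rpow_const _ _ (Or.inl (ne_of_gt hq))).continuousWithinAt

lemma F1_mul_rpow_intervalIntegrable (d n c μ : ℝ) {q : ℝ} (hq : 0 < q) :
    IntervalIntegrable (fun q => F1 d n c q μ * q ^ n) MeasureTheory.volume 1 q := by
  refine ((F1_mul_rpow_continuousOn d n c μ).mono ?_).intervalIntegrable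
  intro x hx
  exact lt_of_lt_of_le (lt_min one_pos hq) hx.1

lemma hasDerivAt_F2 (d n c μ : ℝ) {q : ℝ} (hq : 0 < q) :
    HasDerivAt (fun q => F2 d n c q μ) (F1 d n c q μ * q ^ n) q := by
  have hc := F1_mul_rpow_continuousOn d n c μ
  exact intervalIntegral.integral_hasDerivAt_right (F1_mul_rpow_intervalIntegrable d n c μ hq)
    (hc.stronglyMeasurableAtFilter isOpen_Ioi q hq)
    (hc.continuousAt (Ioi_mem_nhds hq))

lemma hasDerivAt_F1 (d n c μ : ℝ) (hn : 1 < n) {q : ℝ} (hq : 0 < q) :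
    HasDerivAt (fun q => F1 d n c q μ) (q ^ (-n) - n / c / q) q := by
  have h1 : HasDerivAt (fun q : ℝ => q ^ (1 - n)) ((1 - n) * q ^ (1 - n - 1)) q :=
    Real.hasDerivAt_rpow_const (Or.inl hq.ne')
  have h2 := Real.hasDerivAt_log hq.ne'
  have h := (((h1.sub_const 1).const_mul (-(1 / (n - 1)))).sub (h2.const_mul (n / c))).add_const
    (μ * d)
  refine h.congr_deriv ?_
  have : n - 1 ≠ 0 := by linarith
  rw [show 1 - n - 1 = -n by ring]
  field_simp
  ring

lemma F2_sub_eq (d n c μ : ℝ) (hn : 0 < n) {q : ℝ} (hq : 0 < q) :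
    F2 d n c q μ - F2 d n c q 0 = μ * (d * (q ^ (n + 1) - 1) / (n + 1)) := by
  unfold F2
  rw [← intervalIntegral.integral_sub (F1_mul_rpow_intervalIntegrable d n c μ hq)
    (F1_mul_rpow_intervalIntegrable d n c 0 hq)]
  have : (fun x : ℝ => F1 d n c x μ * x ^ n - F1 d n c x 0 * x ^ n)
      = fun x => (μ * d) * x ^ n := by
    funext x
    unfold F1
    ring
  rw [this, intervalIntegral.integral_const_mul, integral_rpow (Or.inl (by linarith)),
    Real.one_rpow]
  ring

/-- To the right of `mu2`, the function `F2` is negative. -/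
lemma F2_neg_of_mu2_lt (d n c μ : ℝ) (hd : 0 < d) (hn : 0 < n) {q : ℝ} (hq : 0 < q) (hq1 : q < 1)
    (h : mu2 d n c q < μ) : F2 d n c q μ < 0 := by
  have e1 := F2_sub_eq d n c 1 hn hq
  have e2 := F2_sub_eq d n c μ hn hq
  have hlt : d * (q ^ (n + 1) - 1) / (n + 1) < 0 := by
    have := Real.rpow_lt_one hq.le hq1 (show 0 < n + 1 by linarith)
    apply div_neg_of_neg_of_pos _ (by linarith)
    nlinarith
  rw [one_mul] at e1
  unfold mu2 at h
  rw [e1, div_lt_iff_of_neg hlt] at h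
  linarith

/-- The second-order data at the origin, as one-sided limits. -/
lemma tendsto_deriv_zero {Q : ℝ → ℝ} {σ μ : ℝ} (hσ : 0 < σ) (hQ : ContDiffOn ℝ 3 Q (Icc 0 σ))
    (h1 : deriv Q 0 = 0) (h2 : deriv (deriv Q) 0 = μ) (hμ : μ ≠ 0) :
    Tendsto (deriv Q) (𝓝[>] 0) (𝓝 0) ∧ Tendsto (fun r => deriv Q r / r) (𝓝[>] 0) (𝓝 μ) ∧
      Tendsto (deriv (deriv Q)) (𝓝[>] 0) (𝓝 μ) := by
  have hd : HasDerivAt (deriv Q) μ 0 := by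
    have : DifferentiableAt ℝ (deriv Q) 0 :=
      differentiableAt_of_deriv_ne_zero (by rw [h2]; exact hμ)
    rw [← h2]
    exact this.hasDerivAt
  have hu : UniqueDiffOn ℝ (Icc 0 σ) := uniqueDiffOn_Icc hσ
  have h0 : (0 : ℝ) ∈ Icc 0 σ := ⟨le_rfl, hσ.le⟩
  set D := derivWithin Q (Icc 0 σ) with hD
  have hDc : ContDiffOn ℝ 2 D (Icc 0 σ) := hQ.derivWithin hu (by norm_num)
  have hD2 : ContDiffOn ℝ 1 (derivWithin D (Icc 0 σ)) (Icc 0 σ) :=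
    hDc.derivWithin hu (by norm_num)
  have hIoo : ∀ᶠ r in 𝓝[>] (0 : ℝ), r ∈ Ioo 0 σ := Ioo_mem_nhdsGT hσ
  have hle : 𝓝[>] (0 : ℝ) ≤ 𝓝[Icc 0 σ] 0 := by
    rw [← nhdsWithin_Ioo_eq_nhdsGT hσ]
    exact nhdsWithin_mono _ Ioo_subset_Icc_self
  have hDeq : ∀ r ∈ Ioo 0 σ, D r = deriv Q r := fun r hr =>
    derivWithin_of_mem_nhds (Icc_mem_nhds hr.1 hr.2)
  have ht : Tendsto (deriv Q) (𝓝[>] 0) (𝓝 0) := by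
    have := hd.continuousAt.tendsto.mono_left (nhdsWithin_le_nhds (s := Ioi 0))
    rwa [h1] at this
  have hD0 : D 0 = 0 := by
    have hl : Tendsto D (𝓝[>] 0) (𝓝 (D 0)) := (hDc.continuousOn 0 h0).tendsto.mono_left hle
    refine tendsto_nhds_unique hl (ht.congr' ?_)
    filter_upwards [hIoo] with r hr using (hDeq r hr).symm
  have hDD : derivWithin D (Icc 0 σ) 0 = μ := by
    have ha : HasDerivWithinAt D (derivWithin D (Icc 0 σ) 0) (Ico 0 σ) 0 :=
      ((hDc.differentiableOn (by norm_num)) 0 h0).hasDerivWithinAt.mono Ico_subset_Icc_self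
    have hb : HasDerivWithinAt D μ (Ico 0 σ) 0 := by
      refine hd.hasDerivWithinAt.congr ?_ (by rw [hD0, h1])
      intro r hr
      rcases eq_or_lt_of_le hr.1 with h | h
      · rw [← h, hD0, h1]
      · exact hDeq r ⟨h, hr.2⟩
    exact ((uniqueDiffOn_Ico 0 σ) 0 ⟨le_rfl, hσ⟩).eq_deriv _ ha hb
  refine ⟨ht, ?_, ?_⟩
  · have := (hasDerivAt_iff_tendsto_slope.1 hd).mono_left
      (nhdsWithin_mono (0 : ℝ) (fun x (hx : 0 < x) => hx.ne'))
    refine this.congr fun r => ?_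
    rw [slope_def_field, h1, sub_zero, sub_zero]
  · have hl := (hD2.continuousOn 0 h0).tendsto.mono_left hle
    rw [hDD] at hl
    refine hl.congr' ?_
    filter_upwards [hIoo] with r hr
    rw [derivWithin_of_mem_nhds (Icc_mem_nhds hr.1 hr.2)]
    apply Filter.EventuallyEq.deriv_eq
    filter_upwards [Ioo_mem_nhds hr.1 hr.2] with s hs using hDeq s hs

/-- The magma equation divided by `Q ^ n`. -/
lemma magmaODE_div {d n c : ℝ} {Q : ℝ → ℝ} {r : ℝ} (hr : 0 < r)
    (hpos : 0 < Q r) {a b e : ℝ} (h1 : HasDerivAt Q a r) (h2 : HasDerivAt (deriv Q) b r)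
    (h3 : HasDerivAt (deriv (deriv Q)) e r) (h : magmaODE d n c Q r) :
    (Q r ^ (-n) - n / c / Q r) * a =
      e + (d - 1) * ((b * r - a) / r ^ 2) + n * a * b / Q r := by
  have hp : HasDerivAt (fun s => Q s ^ n) (a * n * Q r ^ (n - 1)) r :=
    h1.rpow_const (Or.inl hpos.ne')
  have hs : HasDerivAt (fun s => deriv Q s / s) ((b * r - a) / r ^ 2) r := by
    refine (h2.div (hasDerivAt_id' r) hr.ne').congr_deriv ?_
    rw [h1.deriv, mul_one]
  unfold magmaODE at h
  have hps : HasDerivAt (fun s => Q s ^ n * deriv (deriv Q) s) _ r := hp.mul h3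
  rw [hp.deriv, hps.deriv, hs.deriv, h1.deriv, h2.deriv, Real.rpow_sub_one hpos.ne'] at h
  rw [Real.rpow_neg hpos.le]
  have hX : 0 < Q r ^ n := Real.rpow_pos_of_pos hpos n
  generalize (b * r - a) / r ^ 2 = w at *
  generalize Q r ^ n = X at *
  generalize Q r = y at *
  have h' : X⁻¹ * (-a + 1 / c * (a * n * (X / y)) + (a * n * (X / y) * b + X * e)
      + (d - 1) * X * w) = 0 := by rw [h, mul_zero]
  have hXX : X⁻¹ * X = 1 := inv_mul_cancel₀ hX.ne'
  linear_combination (-1 : ℝ) * h' + (n / c / y * a + a * n / y * b + e + (d - 1) * w) * hXX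

/-- Along a decreasing positive solution, `F2` is positive. -/
lemma F2_pos_of_solution {d n c μ : ℝ} (hd : 1 ≤ d) (hn : 1 < n) (hμ : μ ≠ 0)
    {Q : ℝ → ℝ} {σ R : ℝ} (hR : R ∈ Ioo 0 σ) (hQ : isIVPSolutionOn d n c μ Q σ)
    (hmon : ∀ r ∈ Ioc (0 : ℝ) σ, 0 < Q r ∧ deriv Q r < 0) : 0 < F2 d n c (Q R) μ := by
  obtain ⟨hC, hode, hQ0, hQ1, hQ2⟩ := hQ
  have hσ : 0 < σ := hR.1.trans hR.2
  obtain ⟨t1, t2, t3⟩ := tendsto_deriv_zero hσ hC hQ1 hQ2 hμ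
  have hC0 : ContDiffOn ℝ 3 Q (Ioo 0 σ) := hC.mono Ioo_subset_Icc_self
  have hC1 : ContDiffOn ℝ 2 (deriv Q) (Ioo 0 σ) := hC0.deriv_of_isOpen isOpen_Ioo (by norm_num)
  have hC2 : ContDiffOn ℝ 1 (deriv (deriv Q)) (Ioo 0 σ) :=
    hC1.deriv_of_isOpen isOpen_Ioo (by norm_num)
  have d0 : ∀ r ∈ Ioo 0 σ, HasDerivAt Q (deriv Q r) r := fun r hr =>
    ((hC0.differentiableOn (by norm_num)).differentiableAt (Ioo_mem_nhds hr.1 hr.2)).hasDerivAt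
  have d1 : ∀ r ∈ Ioo 0 σ, HasDerivAt (deriv Q) (deriv (deriv Q) r) r := fun r hr =>
    ((hC1.differentiableOn (by norm_num)).differentiableAt (Ioo_mem_nhds hr.1 hr.2)).hasDerivAt
  have d2 : ∀ r ∈ Ioo 0 σ, HasDerivAt (deriv (deriv Q)) (deriv (deriv (deriv Q)) r) r :=
    fun r hr =>
    ((hC2.differentiableOn (by norm_num)).differentiableAt (Ioo_mem_nhds hr.1 hr.2)).hasDerivAt
  have hanti : AntitoneOn Q (Icc 0 σ) := by
    refine antitoneOn_of_deriv_nonpos (convex_Icc 0 σ) hC.continuousOn ?_ ?_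
    · rw [interior_Icc]
      exact hC0.differentiableOn (by norm_num)
    · rw [interior_Icc]
      exact fun r hr => (hmon r ⟨hr.1, hr.2.le⟩).2.le
  set q := Q R with hq
  have hqpos : 0 < q := (hmon R ⟨hR.1, hR.2.le⟩).1
  have hn1 : n + 1 ≠ 0 := by linarith
  let H : ℝ → ℝ := fun y => (y ^ (n + 1) - q ^ (n + 1)) / (n + 1)
  let g : ℝ → ℝ := fun y => (y ^ n + n * q ^ (n + 1) / y) / (n + 1)
  let Ψ : ℝ → ℝ := fun r => F2 d n c (Q r) μ - F1 d n c (Q r) μ * H (Q r)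
    + H (Q r) * (deriv (deriv Q) r + (d - 1) * (deriv Q r / r)) - deriv Q r ^ 2 / 2 * g (Q r)
  have dH : ∀ y : ℝ, 0 < y → HasDerivAt H (y ^ n) y := by
    intro y hy
    have h : HasDerivAt (fun y : ℝ => y ^ (n + 1)) ((n + 1) * y ^ (n + 1 - 1)) y :=
      Real.hasDerivAt_rpow_const (Or.inl hy.ne')
    refine ((h.sub_const (q ^ (n + 1))).div_const (n + 1)).congr_deriv ?_
    rw [add_sub_cancel_right]
    field_simp
  have dg : ∀ y : ℝ, 0 < y →
      HasDerivAt g (n / (n + 1) * (y ^ n / y - q ^ (n + 1) / y ^ 2)) y := by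
    intro y hy
    have h : HasDerivAt (fun y : ℝ => y ^ n) (n * y ^ (n - 1)) y :=
      Real.hasDerivAt_rpow_const (Or.inl hy.ne')
    have h' : HasDerivAt (fun y : ℝ => n * q ^ (n + 1) / y) _ y :=
      (hasDerivAt_const y (n * q ^ (n + 1))).div (hasDerivAt_id' y) hy.ne'
    refine ((h.add h').div_const (n + 1)).congr_deriv ?_
    rw [Real.rpow_sub_one hy.ne']
    field_simp
    ring
  have dΨ : ∀ r ∈ Ioo 0 σ, HasDerivAt Ψ ((d - 1) * Q r ^ n * deriv Q r ^ 2 / r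
      - deriv Q r ^ 2 / 2 * (n / (n + 1) * (Q r ^ n / Q r - q ^ (n + 1) / Q r ^ 2))
        * deriv Q r) r := by
    intro r hr
    have hp := (hmon r ⟨hr.1, hr.2.le⟩).1
    have e := magmaODE_div hr.1 hp (d0 r hr) (d1 r hr) (d2 r hr) (hode r hr)
    have a2 := (hasDerivAt_F2 d n c μ hp).comp r (d0 r hr)
    have a1 := (hasDerivAt_F1 d n c μ hn hp).comp r (d0 r hr)
    have aH := (dH (Q r) hp).comp r (d0 r hr)
    have ag := (dg (Q r) hp).comp r (d0 r hr)
    have as := (d1 r hr).div (hasDerivAt_id' r) hr.1.ne'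
    have aE := ((d1 r hr).pow 2).div_const 2
    have aΨ := ((a2.sub (a1.mul aH)).add (aH.mul ((d2 r hr).add (as.const_mul (d - 1))))).sub
      (aE.mul ag)
    refine aΨ.congr_deriv ?_
    simp only [Function.comp_apply, Pi.div_apply, Pi.add_apply, Pi.pow_apply, e, H, g]
    rw [Real.rpow_add_one hp.ne']
    have hr0 := hr.1.ne'
    have hp0 := hp.ne'
    field_simp
    ring
  have hmonΨ : MonotoneOn Ψ (Ioc 0 R) := by
    have hsub : ∀ r ∈ Ioc 0 R, r ∈ Ioo 0 σ := fun r hr => ⟨hr.1, hr.2.trans_lt hR.2⟩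
    refine monotoneOn_of_deriv_nonneg (convex_Ioc 0 R)
      (fun r hr => (dΨ r (hsub r hr)).continuousAt.continuousWithinAt) ?_ ?_
    · exact fun r hr => (dΨ r (hsub r (interior_subset hr))).differentiableAt.differentiableWithinAt
    · intro r hr
      have hr' := interior_subset hr
      have hrσ := hsub r hr'
      rw [(dΨ r hrσ).deriv]
      obtain ⟨hp, hneg⟩ := hmon r ⟨hrσ.1, hrσ.2.le⟩
      have hle : q ≤ Q r := hanti ⟨hrσ.1.le, hrσ.2.le⟩ ⟨hR.1.le, hR.2.le⟩ hr'.2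
      have hgn : 0 ≤ Q r ^ n / Q r - q ^ (n + 1) / Q r ^ 2 := by
        have h1 : q ^ (n + 1) ≤ Q r ^ (n + 1) :=
          Real.rpow_le_rpow hqpos.le hle (by linarith)
        have h2 : Q r ^ n / Q r = Q r ^ (n + 1) / Q r ^ 2 := by
          rw [Real.rpow_add_one hp.ne']
          field_simp
        rw [h2, ← sub_div]
        exact div_nonneg (by linarith) (by positivity)
      have h1 : 0 ≤ (d - 1) * Q r ^ n * deriv Q r ^ 2 / r :=
        div_nonneg (mul_nonneg (mul_nonneg (by linarith) (Real.rpow_nonneg hp.le n))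
          (sq_nonneg _)) hrσ.1.le
      have h2 : 0 ≤ deriv Q r ^ 2 / 2 *
          (n / (n + 1) * (Q r ^ n / Q r - q ^ (n + 1) / Q r ^ 2)) :=
        mul_nonneg (by positivity) (mul_nonneg (div_nonneg (by linarith) (by linarith)) hgn)
      nlinarith
  have htΨ : Tendsto Ψ (𝓝[>] 0) (𝓝 0) := by
    have tQ : Tendsto Q (𝓝[>] 0) (𝓝 1) := by
      have hc := (hC.continuousOn 0 ⟨le_rfl, hσ.le⟩).tendsto
      rw [hQ0] at hc
      refine hc.mono_left ?_
      rw [← nhdsWithin_Ioo_eq_nhdsGT hσ]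
      exact nhdsWithin_mono _ Ioo_subset_Icc_self
    have b2 := (hasDerivAt_F2 d n c μ one_pos).continuousAt.tendsto.comp tQ
    have b1 := (hasDerivAt_F1 d n c μ hn one_pos).continuousAt.tendsto.comp tQ
    have bH := (dH 1 one_pos).continuousAt.tendsto.comp tQ
    have bg := (dg 1 one_pos).continuousAt.tendsto.comp tQ
    have bΨ := ((b2.sub (b1.mul bH)).add (bH.mul (t3.add (t2.const_mul (d - 1))))).sub
      (((t1.pow 2).div_const 2).mul bg)
    have hlim : F2 d n c 1 μ - F1 d n c 1 μ * H 1 + H 1 * (μ + (d - 1) * μ)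
        - 0 ^ 2 / 2 * g 1 = 0 := by
      have hF1 : F1 d n c 1 μ = μ * d := by simp [F1]
      have hF2 : F2 d n c 1 μ = 0 := by simp [F2]
      rw [hF1, hF2]
      ring
    rw [hlim] at bΨ
    exact bΨ
  have hΨR : 0 ≤ Ψ R := by
    refine le_of_tendsto htΨ ?_
    filter_upwards [Ioo_mem_nhdsGT hR.1] with r hr
    exact hmonΨ ⟨hr.1, hr.2.le⟩ ⟨hR.1, le_rfl⟩ hr.2.le
  have hHq : H q = 0 := by simp [H]
  have hg : 0 < g q := by
    have h1 := Real.rpow_pos_of_pos hqpos n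
    have h2 := Real.rpow_pos_of_pos hqpos (n + 1)
    have h3 : 0 < n + 1 := by linarith
    have h4 : 0 < n := by linarith
    simp only [g]
    positivity
  have hE : 0 < deriv Q R ^ 2 / 2 * g q := by
    have := (hmon R ⟨hR.1, hR.2.le⟩).2
    exact mul_pos (by nlinarith) hg
  simp only [Ψ, ← hq, hHq, mul_zero, zero_mul] at hΨR
  linarith

/-- (μ₂(Q₂), 0) ∩ A = ∅ (Lemma "empty"). -/
theorem magma_Ioo_inter_setA_empty
    (d : ℕ) (hd : 1 ≤ d) (n c Qs Q2 : ℝ)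
    (hn : n ∈ Icc (2:ℝ) 3) (hc : c ∈ Ico (1.55:ℝ) n)
    (hQs : Qs ∈ Ioo (0:ℝ) 1) (hQsz : F3 (d:ℝ) n c Qs 1 - F3 (d:ℝ) n c Qs 0 = 0)
    (hQsu : ∀ q ∈ Ioo (0:ℝ) 1, F3 (d:ℝ) n c q 1 - F3 (d:ℝ) n c q 0 = 0 → q = Qs)
    (hQ2 : Q2 ∈ Ioo Qs 1)
    (hQ2min : ∀ Q ∈ Ioo Qs (1:ℝ), mu2 (d:ℝ) n c Q2 ≤ mu2 (d:ℝ) n c Q)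
    (hQ2uniq : ∀ Q ∈ Ioo Qs (1:ℝ), mu2 (d:ℝ) n c Q = mu2 (d:ℝ) n c Q2 → Q = Q2) :
    Ioo (mu2 (d:ℝ) n c Q2) 0 ∩ setA (d:ℝ) n c Qs = ∅ := by
  rw [Set.eq_empty_iff_forall_notMem]
  rintro μ ⟨hμ, hμ0, Q, σ, rs, hrs, hrsσ, hsol, hmon, hQrs⟩
  have hd' : (1 : ℝ) ≤ d := by exact_mod_cast hd
  have hcont : ContinuousOn Q (Icc 0 rs) :=
    hsol.1.continuousOn.mono (Icc_subset_Icc_right hrsσ.le)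
  obtain ⟨R, hR, hQR⟩ : Q2 ∈ Q '' Ioo 0 rs := by
    apply intermediate_value_Ioo' hrs.le hcont
    rw [hQrs, hsol.2.2.1]
    exact hQ2
  have hpos := F2_pos_of_solution hd' (by linarith [hn.1]) hμ0.ne ⟨hR.1, hR.2.trans hrsσ⟩ hsol hmon
  rw [hQR] at hpos
  have hneg := F2_neg_of_mu2_lt d n c μ (by linarith) (by linarith [hn.1]) (hQs.1.trans hQ2.1)
    hQ2.2 hμ.1
  linarith
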